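/- (Lorenz gauge condition for the Liénard–Wiechert potential.) Let c > 0, let C : ℝ → (Fin 4 → ℝ) be twice differentiable with g (deriv C s) (deriv C s) = -c^2 for all s, let τ be a retarded-time map for C on an open set U, and let x ∈ U with τ differentiable at x and g X V ≠ 0, where X = x - C (τ x) and V = deriv C (τ x). Then the Minkowski divergence of the Liénard–Wiechert potential vanishes at x: ∑ (a : Fin 4), fderiv ℝ (fun y => deriv C (τ y) a / g (y - C (τ y)) (deriv C (τ y))) x (Pi.single a 1) = 0. -/

import Mathlib

/-- The Minkowski bilinear form on `ℝ⁴ = Fin 4 → ℝ`. -/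
noncomputable def g (u v : Fin 4 → ℝ) : ℝ :=
  -(u 0 * v 0) + u 1 * v 1 + u 2 * v 2 + u 3 * v 3

/-- The product rule for the Minkowski form. -/
theorem exists_hasFDerivAt_g {E : Type*} [NormedAddCommGroup E] [NormedSpace ℝ E]
    {u v : E → (Fin 4 → ℝ)} {u' v' : E →L[ℝ] (Fin 4 → ℝ)} {x : E}
    (hu : HasFDerivAt u u' x) (hv : HasFDerivAt v v' x) :
    ∃ L : E →L[ℝ] ℝ, HasFDerivAt (fun y => g (u y) (v y)) L x ∧
      ∀ e, L e = g (u' e) (v x) + g (u x) (v' e) := by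
  have h (i : Fin 4) := (hasFDerivAt_pi'.1 hu i).mul (hasFDerivAt_pi'.1 hv i)
  refine ⟨_, (((h 0).neg.add (h 1)).add (h 2)).add (h 3), fun e => ?_⟩
  simp [g]
  ring

theorem stmt6 (c : ℝ) (hc : 0 < c)
    (C : ℝ → (Fin 4 → ℝ))
    (hC1 : Differentiable ℝ C) (hC2 : Differentiable ℝ (deriv C))
    (hnorm : ∀ s : ℝ, g (deriv C s) (deriv C s) = -c ^ 2)
    (U : Set (Fin 4 → ℝ)) (hU : IsOpen U)
    (τ : (Fin 4 → ℝ) → ℝ)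
    (hτ : ∀ y ∈ U, g (y - C (τ y)) (y - C (τ y)) = 0)
    (x : Fin 4 → ℝ) (hx : x ∈ U)
    (hdiff : DifferentiableAt ℝ τ x)
    (hne : g (x - C (τ x)) (deriv C (τ x)) ≠ 0) :
    ∑ a : Fin 4,
      fderiv ℝ
        (fun y => deriv C (τ y) a / g (y - C (τ y)) (deriv C (τ y))) x
        (Pi.single a 1) = 0 := by
  set T := fderiv ℝ τ x
  set V := deriv C (τ x)
  set A := deriv (deriv C) (τ x)
  set X := x - C (τ x)
  have hCτ : HasFDerivAt (fun y => C (τ y)) (T.smulRight V) x :=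
    ((hC1 (τ x)).hasDerivAt.hasFDerivAt.comp x hdiff.hasFDerivAt).congr_fderiv (by ext; simp [T, V])
  have hVτ : HasFDerivAt (fun y => deriv C (τ y)) (T.smulRight A) x :=
    ((hC2 (τ x)).hasDerivAt.hasFDerivAt.comp x hdiff.hasFDerivAt).congr_fderiv (by ext; simp [T, A])
  have hXτ := (hasFDerivAt_id (𝕜 := ℝ) x).sub hCτ
  obtain ⟨N, hN, hNe⟩ := exists_hasFDerivAt_g hXτ hXτ
  obtain ⟨L, hL, hLe⟩ := exists_hasFDerivAt_g hXτ hVτ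
  have hN0 : N = 0 := by
    refine hN.unique ((hasFDerivAt_const (0 : ℝ) x).congr_of_eventuallyEq ?_)
    filter_upwards [hU.mem_nhds hx] with y hy using hτ y hy
  have hT (e : Fin 4 → ℝ) : T e * g X V = g X e := by
    have h := hNe e
    simp [hN0, g] at h
    simp only [g, X, Pi.sub_apply]
    linarith
  have hLe' (e : Fin 4 → ℝ) : L e = g e V - T e * g V V + T e * g X A := by
    rw [hLe]
    simp [g, X, V]
    ring
  have hdiv (a : Fin 4) :
      fderiv ℝ (fun y => deriv C (τ y) a / g (y - C (τ y)) (deriv C (τ y))) x (Pi.single a 1) =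
        (T (Pi.single a 1) * A a * g X V - V a * L (Pi.single a 1)) / g X V ^ 2 := by
    have h := (hasFDerivAt_pi'.1 hVτ a).mul ((hasDerivAt_inv hne).comp_hasFDerivAt x hL)
    refine (congrArg (fun M => M (Pi.single a 1)) h.fderiv).trans ?_
    simp [X, V]
    field_simp
    ring
  simp only [hdiv, ← Finset.sum_div]
  refine div_eq_zero_iff.2 (Or.inl ?_)
  have hsum (W : Fin 4 → ℝ) : ∑ a, T (Pi.single a 1) * W a = T W := by
    conv_rhs => rw [pi_eq_sum_univ' W]
    simp [mul_comm]
  have hTV : T V = 1 := mul_right_cancel₀ hne (by rw [hT, one_mul])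
  have hTA := hT A
  rw [← hsum] at hTV hTA
  simp only [hLe', Fin.sum_univ_four] at hTV hTA ⊢
  have hgV : V 0 * g (Pi.single 0 1) V + V 1 * g (Pi.single 1 1) V +
      V 2 * g (Pi.single 2 1) V + V 3 * g (Pi.single 3 1) V = g V V := by
    simp [g]
  linear_combination hTA - hgV + (g V V - g X A) * hTV
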